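/- For α > -1 and r ∈ (0,1), the derivative of M_α satisfies (d/dr) M_α(r) = (α²/2) · ((Γ(1+α/2))²/Γ(1+α)) · r · F(1−α/2, 1−α/2; 2; r²); moreover, if α > 0 then lim_{r→1⁻} (d/dr) M_α(r) = α/2. -/

import Mathlib

open Real

/-- Pochhammer symbol `(a)_n = a(a+1)⋯(a+n-1)` for real `a`. -/
noncomputable def poch (a : ℝ) (n : ℕ) : ℝ := ∏ i ∈ Finset.range n, (a + (i : ℝ))

/-- Gauss hypergeometric function `F(a,b;c;x)` as a power series sum. -/
noncomputable def hyperF (a b c x : ℝ) : ℝ :=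
  ∑' n : ℕ, (poch a n * poch b n) / (poch c n * (n.factorial : ℝ)) * x ^ n

/-- `M_α(r) = (Γ(1+α/2)²/Γ(1+α)) F(-α/2,-α/2;1;r²)`. -/
noncomputable def Mfun (α r : ℝ) : ℝ :=
  (Real.Gamma (1 + α / 2)) ^ 2 / Real.Gamma (1 + α) *
    hyperF (-(α / 2)) (-(α / 2)) 1 (r ^ 2)

open Filter Topology Finset

lemma poch_succ (a : ℝ) (n : ℕ) : poch a (n + 1) = poch a n * (a + n) :=
  prod_range_succ _ _

lemma poch_succ_left (a : ℝ) (n : ℕ) : poch a (n + 1) = a * poch (a + 1) n := by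
  rw [poch, prod_range_succ', poch, mul_comm]
  congr 1
  · simp
  · exact prod_congr rfl fun i _ => by push_cast; ring

lemma poch_pos {a : ℝ} (ha : 0 < a) (n : ℕ) : 0 < poch a n :=
  prod_pos fun _ _ => by positivity

lemma poch_le_poch {a b : ℝ} (ha : 0 < a) (hab : a ≤ b) (n : ℕ) : poch a n ≤ poch b n :=
  prod_le_prod (fun _ _ => by positivity) fun _ _ => by linarith

/-- The `n`-th power series coefficient of `F(a,a;c;x)`. -/
noncomputable def hyperCoeff (a c : ℝ) (n : ℕ) : ℝ :=
  (poch a n * poch a n) / (poch c n * (n.factorial : ℝ))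

lemma hyperF_eq_tsum (a c x : ℝ) : hyperF a a c x = ∑' n, hyperCoeff a c n * x ^ n := rfl

lemma hyperCoeff_zero (a c : ℝ) : hyperCoeff a c 0 = 1 := by
  simp [hyperCoeff, poch]

section

variable {a c : ℝ}

lemma hyperCoeff_nonneg (hc : 0 < c) (n : ℕ) : 0 ≤ hyperCoeff a c n :=
  div_nonneg (mul_self_nonneg _) (mul_pos (poch_pos hc n) (by positivity)).le

lemma succ_mul_hyperCoeff_succ (hc : 0 < c) (n : ℕ) :
    (n + 1 : ℝ) * hyperCoeff a c (n + 1) = hyperCoeff a c n * ((a + n) ^ 2 / (c + n)) := by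
  have h := (poch_pos hc n).ne'
  have h' : (n.factorial : ℝ) ≠ 0 := by positivity
  have h'' : c + n ≠ 0 := by positivity
  have h3 : (n + 1 : ℝ) ≠ 0 := by positivity
  simp only [hyperCoeff, poch_succ, Nat.factorial_succ]
  push_cast
  field_simp

lemma succ_mul_hyperCoeff_succ_eq_shift (hc : 0 < c) (n : ℕ) :
    (n + 1 : ℝ) * hyperCoeff a c (n + 1) = a ^ 2 / c * hyperCoeff (a + 1) (c + 1) n := by
  have h := (poch_pos (add_pos hc one_pos) n).ne'
  have h' : (n.factorial : ℝ) ≠ 0 := by positivity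
  have h3 : (n + 1 : ℝ) ≠ 0 := by positivity
  simp only [hyperCoeff, poch_succ_left, Nat.factorial_succ]
  push_cast
  field_simp

lemma hyperCoeff_add_one (hc : 0 < c) (n : ℕ) :
    hyperCoeff a (c + 1) n = hyperCoeff a c n * (c / (c + n)) := by
  have h := (poch_pos hc n).ne'
  have h1 := (poch_pos (add_pos hc one_pos) n).ne'
  have h' : (n.factorial : ℝ) ≠ 0 := by positivity
  have h'' : c + n ≠ 0 := by positivity
  have e : poch c n * (c + n) = c * poch (c + 1) n := by rw [← poch_succ, poch_succ_left]
  simp only [hyperCoeff]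
  field_simp
  linear_combination poch a n ^ 2 * e

lemma mul_hyperCoeff_sub_succ (hc : 0 < c) (n : ℕ) :
    n * hyperCoeff a c n - (n + 1 : ℝ) * hyperCoeff a c (n + 1) =
      hyperCoeff a c n * (((c - 2 * a) * n - a ^ 2) / (c + n)) := by
  have h'' : c + n ≠ 0 := by positivity
  rw [succ_mul_hyperCoeff_succ hc]
  field_simp
  ring

lemma summable_hyperCoeff (hc : 0 < c) (hca : 0 < c - 2 * a) : Summable (hyperCoeff a c) := by
  obtain ⟨N, hN⟩ := exists_nat_ge (((c - 2 * a) * c + 2 * a ^ 2) / (c - 2 * a))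
  rw [div_le_iff₀ hca] at hN
  rw [← summable_nat_add_iff N]
  have key : ∀ k : ℕ, (c - 2 * a) / 2 * ∑ i ∈ range k, hyperCoeff a c (i + N) ≤
      N * hyperCoeff a c N - (k + N : ℕ) * hyperCoeff a c (k + N) := by
    intro k
    induction k with
    | zero => simp
    | succ k ih =>
      have h := mul_hyperCoeff_sub_succ (a := a) hc (k + N)
      have h2 : (c - 2 * a) / 2 ≤ ((c - 2 * a) * (k + N : ℕ) - a ^ 2) / (c + (k + N : ℕ)) := by
        rw [le_div_iff₀ (by positivity)]
        push_cast
        nlinarith [mul_nonneg hca.le (Nat.cast_nonneg (α := ℝ) k)]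
      have h3 := mul_le_mul_of_nonneg_left h2 (hyperCoeff_nonneg (a := a) hc (k + N))
      rw [sum_range_succ, show k + 1 + N = k + N + 1 by ring]
      push_cast at *
      nlinarith
  refine summable_of_sum_range_le (c := N * hyperCoeff a c N / ((c - 2 * a) / 2))
    (fun n => hyperCoeff_nonneg hc _) fun k => ?_
  rw [le_div_iff₀ (by positivity), mul_comm]
  exact (key k).trans (sub_le_self _ (mul_nonneg (Nat.cast_nonneg _) (hyperCoeff_nonneg hc _)))

lemma tendsto_mul_hyperCoeff (hc : 0 < c) (hca : 0 < c - 2 * a) :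
    Tendsto (fun n : ℕ => n * hyperCoeff a c n) atTop (𝓝 0) := by
  have hs := summable_hyperCoeff hc hca
  have hs1 : Summable fun n => hyperCoeff a c n * (((c - 2 * a) * n - a ^ 2) / (c + n)) := by
    have h2 : Summable (hyperCoeff a (c + 1)) :=
      summable_hyperCoeff (by linarith) (by linarith)
    refine ((hs.mul_left (c - 2 * a)).sub (h2.mul_left ((c - a) ^ 2 / c))).congr fun n => ?_
    have h'' : c + n ≠ 0 := by positivity
    rw [hyperCoeff_add_one hc]
    field_simp
    ring
  obtain ⟨l, hl⟩ : ∃ l, Tendsto (fun n : ℕ => n * hyperCoeff a c n) atTop (𝓝 l) := by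
    refine ⟨_, (hs1.hasSum.tendsto_sum_nat.neg).congr fun n => ?_⟩
    have := sum_range_sub' (fun n : ℕ => n * hyperCoeff a c n) n
    rw [← sum_congr rfl fun i _ => (mul_hyperCoeff_sub_succ (a := a) hc i)]
    push_cast at this
    rw [this]
    simp
  have hl0 : 0 ≤ l := ge_of_tendsto' hl fun n =>
    mul_nonneg (Nat.cast_nonneg _) (hyperCoeff_nonneg hc _)
  rcases hl0.eq_or_lt with rfl | hpos
  · exact hl
  exfalso
  refine Real.not_summable_one_div_natCast ?_
  refine Summable.of_norm_bounded_eventually_nat (hs.mul_left (2 / l)) ?_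
  filter_upwards [hl.eventually_const_le (half_lt_self hpos), eventually_gt_atTop 0] with n hn hn0
  have : (0 : ℝ) < n := by exact_mod_cast hn0
  rw [Real.norm_of_nonneg (by positivity), div_le_iff₀ this, div_mul_eq_mul_div,
    div_mul_eq_mul_div, le_div_iff₀ hpos]
  linarith

lemma tsum_hyperCoeff_contiguous (hc : 0 < c) (hca : 0 < c - 2 * a) :
    ∑' n, hyperCoeff a c n =
      (c - a) ^ 2 / (c * (c - 2 * a)) * ∑' n, hyperCoeff a (c + 1) n := by
  have hs := summable_hyperCoeff hc hca
  have h2 : Summable (hyperCoeff a (c + 1)) :=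
    summable_hyperCoeff (by linarith) (by linarith)
  have hd := (hs.mul_left (c - 2 * a)).sub (h2.mul_left ((c - a) ^ 2 / c))
  have ht : Tendsto (fun n : ℕ => ∑ i ∈ range n,
      ((c - 2 * a) * hyperCoeff a c i - (c - a) ^ 2 / c * hyperCoeff a (c + 1) i))
      atTop (𝓝 0) := by
    have h0 := (tendsto_mul_hyperCoeff hc hca).neg
    rw [neg_zero] at h0
    refine h0.congr fun n => ?_
    have := sum_range_sub' (fun n : ℕ => n * hyperCoeff a c n) n
    simp only [Nat.cast_zero, zero_mul, zero_sub] at this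
    rw [← this]
    refine sum_congr rfl fun i _ => ?_
    push_cast
    rw [mul_hyperCoeff_sub_succ hc, hyperCoeff_add_one hc]
    have h'' : c + i ≠ 0 := by positivity
    field_simp
    ring
  have h := tendsto_nhds_unique hd.hasSum.tendsto_sum_nat ht
  rw [(hs.mul_left _).tsum_sub (h2.mul_left _), tsum_mul_left, tsum_mul_left] at h
  field_simp at h ⊢
  linarith

lemma tsum_hyperCoeff_iterate (hc : 0 < c) (hca : 0 < c - 2 * a) (m : ℕ) :
    ∑' n, hyperCoeff a c n =
      poch (c - a) m ^ 2 / (poch c m * poch (c - 2 * a) m) * ∑' n, hyperCoeff a (c + m) n := by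
  induction m with
  | zero => simp [poch]
  | succ m ih =>
    have hm : (0 : ℝ) ≤ m := Nat.cast_nonneg m
    rw [ih, tsum_hyperCoeff_contiguous (c := c + m) (by linarith) (by linarith)]
    simp only [poch_succ]
    have := (poch_pos hc m).ne'
    have := (poch_pos hca m).ne'
    have h1 : c + m ≠ 0 := by positivity
    have h2 : c - 2 * a + m ≠ 0 := by positivity
    rw [show c + m - 2 * a = c - 2 * a + m by ring, show c + m - a = c - a + m by ring,
      show c + ((m + 1 : ℕ) : ℝ) = c + m + 1 by push_cast; ring]
    field_simp

lemma hyperCoeff_add_le (hc : 0 < c) {d : ℝ} (hd : 0 ≤ d) (n : ℕ) :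
    hyperCoeff a (c + d) n ≤ (if n = 0 then 1 else 0) + c / (c + d) * hyperCoeff a c n := by
  cases n with
  | zero => simpa [hyperCoeff_zero] using by positivity
  | succ k =>
    have h1 := poch_pos (add_pos hc one_pos) k
    have hle := poch_le_poch (add_pos hc one_pos) (show c + 1 ≤ c + d + 1 by linarith) k
    have hf : (0 : ℝ) < (k + 1).factorial := by positivity
    have e : c / (c + d) * hyperCoeff a c (k + 1) = poch a (k + 1) * poch a (k + 1) /
        ((c + d) * poch (c + 1) k * (k + 1).factorial) := by
      rw [hyperCoeff, poch_succ_left c]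
      field_simp
    rw [if_neg (Nat.succ_ne_zero k), zero_add, e, hyperCoeff, poch_succ_left (c + d)]
    have := mul_self_nonneg (poch a (k + 1))
    gcongr

lemma tendsto_tsum_hyperCoeff_add_nat (hc : 0 < c) (hca : 0 < c - 2 * a) :
    Tendsto (fun m : ℕ => ∑' n, hyperCoeff a (c + m) n) atTop (𝓝 1) := by
  have hs := summable_hyperCoeff hc hca
  have hlim : Tendsto (fun m : ℕ => 1 + c / (c + m) * ∑' n, hyperCoeff a c n) atTop (𝓝 1) := by
    have : Tendsto (fun m : ℕ => c / (c + (m : ℝ))) atTop (𝓝 0) :=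
      tendsto_const_nhds.div_atTop (tendsto_atTop_add_const_left _ _ tendsto_natCast_atTop_atTop)
    simpa using (this.mul_const (∑' n, hyperCoeff a c n)).const_add 1
  have hsm (m : ℕ) : Summable (hyperCoeff a (c + m)) := by
    have hm : (0 : ℝ) ≤ m := Nat.cast_nonneg m
    exact summable_hyperCoeff (by linarith) (by linarith)
  refine tendsto_of_tendsto_of_tendsto_of_le_of_le tendsto_const_nhds hlim (fun m => ?_)
    fun m => ?_
  · have h := (hsm m).le_tsum 0 fun n _ => hyperCoeff_nonneg (by positivity) n
    rwa [hyperCoeff_zero] at h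
  · have hi := hasSum_ite_eq (0 : ℕ) (1 : ℝ)
    exact hasSum_le (hyperCoeff_add_le hc (Nat.cast_nonneg m)) (hsm m).hasSum
      (hi.add (hs.hasSum.mul_left _))

lemma tendsto_poch_ratio (hc : 0 < c) (hca : 0 < c - 2 * a) :
    Tendsto (fun m => poch (c - a) m ^ 2 / (poch c m * poch (c - 2 * a) m)) atTop
      (𝓝 (Gamma c * Gamma (c - 2 * a) / Gamma (c - a) ^ 2)) := by
  have hpos : 0 < c - a := by linarith
  rw [← tendsto_add_atTop_iff_nat 1]
  have h := ((GammaSeq_tendsto_Gamma c).mul (GammaSeq_tendsto_Gamma (c - 2 * a))).div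
    ((GammaSeq_tendsto_Gamma (c - a)).pow 2) (pow_pos (Gamma_pos_of_pos hpos) 2).ne'
  refine h.congr' ?_
  filter_upwards [eventually_gt_atTop 0] with n hn
  have hn : (0 : ℝ) < n := by exact_mod_cast hn
  have e (s : ℝ) : GammaSeq s n = (n : ℝ) ^ s * n.factorial / poch s (n + 1) := rfl
  have hp : (n : ℝ) ^ c * (n : ℝ) ^ (c - 2 * a) = ((n : ℝ) ^ (c - a)) ^ 2 := by
    rw [sq, ← rpow_add hn, ← rpow_add hn]
    ring_nf
  have := (poch_pos hc (n + 1)).ne'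
  have := (poch_pos hca (n + 1)).ne'
  have := (poch_pos hpos (n + 1)).ne'
  have := (rpow_pos_of_pos hn (c - a)).ne'
  have : (n.factorial : ℝ) ≠ 0 := by positivity
  simp only [Pi.div_apply, e]
  rw [div_mul_div_comm, mul_mul_mul_comm, hp]
  field_simp

/-- Gauss's summation formula for `F(a,a;c;1)`. -/
lemma tsum_hyperCoeff (hc : 0 < c) (hca : 0 < c - 2 * a) :
    ∑' n, hyperCoeff a c n = Gamma c * Gamma (c - 2 * a) / Gamma (c - a) ^ 2 := by
  have h := (tendsto_poch_ratio hc hca).mul (tendsto_tsum_hyperCoeff_add_nat hc hca)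
  rw [mul_one] at h
  exact tendsto_nhds_unique
    (tendsto_const_nhds.congr fun m => tsum_hyperCoeff_iterate hc hca m) h

lemma hasDerivAt_hyperF (hc : 0 < c) (hca : 0 < c - 2 * a) {x : ℝ} (hx : |x| < 1) :
    HasDerivAt (hyperF a a c) (a ^ 2 / c * hyperF (a + 1) (a + 1) (c + 1) x) x := by
  obtain ⟨ρ, hxρ, hρ⟩ := exists_between hx
  have hρ0 : 0 < ρ := (abs_nonneg x).trans_lt hxρ
  obtain ⟨C, hC⟩ := (tendsto_mul_hyperCoeff hc hca).bddAbove_range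
  have hu : Summable fun n : ℕ => C * ρ ^ (n - 1) := by
    rw [← summable_nat_add_iff 1]
    exact (summable_geometric_of_lt_one hρ0.le hρ).mul_left C
  have hbound (n : ℕ) (y : ℝ) (hy : y ∈ Metric.ball (0 : ℝ) ρ) :
      ‖hyperCoeff a c n * (n * y ^ (n - 1))‖ ≤ C * ρ ^ (n - 1) := by
    have h0 := mul_nonneg (Nat.cast_nonneg (α := ℝ) n) (hyperCoeff_nonneg (a := a) hc n)
    have hCn := hC (Set.mem_range_self n)
    have hy : |y| ≤ ρ := by simpa using (mem_ball_zero_iff.mp hy).le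
    rw [← mul_assoc, mul_comm (hyperCoeff a c n), norm_mul, Real.norm_of_nonneg h0, norm_pow,
      Real.norm_eq_abs]
    exact mul_le_mul hCn (by gcongr) (by positivity) (h0.trans hCn)
  have hxb : x ∈ Metric.ball (0 : ℝ) ρ := by simpa using hxρ
  have hd := hasDerivAt_tsum_of_isPreconnected hu Metric.isOpen_ball
    (convex_ball (0 : ℝ) ρ).isPreconnected
    (fun n y _ => (hasDerivAt_pow n y).const_mul (hyperCoeff a c n)) hbound
    (Metric.mem_ball_self hρ0)
    (summable_of_ne_finset_zero (s := {0}) fun n hn => by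
      rw [zero_pow (by simpa using hn), mul_zero]) hxb
  have hsum : Summable fun n : ℕ => hyperCoeff a c n * (n * x ^ (n - 1)) :=
    .of_norm_bounded hu fun n => hbound n x hxb
  refine hd.congr_deriv ?_
  symm
  rw [hsum.tsum_eq_zero_add, hyperF_eq_tsum, ← tsum_mul_left]
  simp only [Nat.cast_zero, zero_mul, mul_zero, zero_add, Nat.add_sub_cancel]
  refine tsum_congr fun n => ?_
  rw [← mul_assoc (a ^ 2 / c), ← succ_mul_hyperCoeff_succ_eq_shift hc]
  push_cast
  ring

lemma tendsto_hyperF_one (hc : 0 < c) (hca : 0 < c - 2 * a) :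
    Tendsto (hyperF a a c) (𝓝[<] 1) (𝓝 (Gamma c * Gamma (c - 2 * a) / Gamma (c - a) ^ 2)) := by
  rw [← tsum_hyperCoeff hc hca]
  exact Real.tendsto_tsum_powerSeries_nhdsWithin_lt
    (summable_hyperCoeff hc hca).hasSum.tendsto_sum_nat

end

lemma hasDerivAt_Mfun {α : ℝ} (hα : -1 < α) {r : ℝ} (hr : r ∈ Set.Ioo (0 : ℝ) 1) :
    HasDerivAt (Mfun α)
      (α ^ 2 / 2 * ((Gamma (1 + α / 2)) ^ 2 / Gamma (1 + α)) * r *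
        hyperF (1 - α / 2) (1 - α / 2) 2 (r ^ 2)) r := by
  have hx : |r ^ 2| < 1 := by
    rw [abs_of_nonneg (sq_nonneg r)]
    exact pow_lt_one₀ hr.1.le hr.2 two_ne_zero
  have h := hasDerivAt_hyperF (a := -(α / 2)) (c := 1) one_pos (by linarith) hx
  have hcomp := HasDerivAt.comp (h := fun r : ℝ => r ^ 2) r h (hasDerivAt_pow 2 r)
  refine (hcomp.const_mul (Gamma (1 + α / 2) ^ 2 / Gamma (1 + α))).congr_deriv ?_
  rw [show -(α / 2) + 1 = 1 - α / 2 by ring, show (1 : ℝ) + 1 = 2 by norm_num]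
  push_cast
  ring

theorem deriv_Mfun (α : ℝ) (hα : -1 < α) :
    (∀ r ∈ Set.Ioo (0 : ℝ) 1,
      HasDerivAt (Mfun α)
        (α ^ 2 / 2 * ((Real.Gamma (1 + α / 2)) ^ 2 / Real.Gamma (1 + α)) * r *
          hyperF (1 - α / 2) (1 - α / 2) 2 (r ^ 2)) r) ∧
    (0 < α →
      Filter.Tendsto (fun r => deriv (Mfun α) r) (nhdsWithin 1 (Set.Iio 1))
        (nhds (α / 2))) := by
  refine ⟨fun r hr => hasDerivAt_Mfun hα hr, fun hα0 => ?_⟩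
  have hsq : Tendsto (fun r : ℝ => r ^ 2) (𝓝[<] 1) (𝓝[<] 1) := by
    refine tendsto_nhdsWithin_iff.mpr ⟨?_, ?_⟩
    · exact ((continuous_pow 2).tendsto' (1 : ℝ) 1 (one_pow 2)).mono_left nhdsWithin_le_nhds
    · filter_upwards [Ioo_mem_nhdsLT (zero_lt_one' ℝ)] with r hr
      exact pow_lt_one₀ hr.1.le hr.2 two_ne_zero
  have hF := (tendsto_hyperF_one (a := 1 - α / 2) (c := 2) two_pos (by linarith)).comp hsq
  have hid : Tendsto (fun r : ℝ => r) (𝓝[<] 1) (𝓝 1) := nhdsWithin_le_nhds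
  have h := (hid.const_mul (α ^ 2 / 2 * (Gamma (1 + α / 2) ^ 2 / Gamma (1 + α)))).mul hF
  have hval : α ^ 2 / 2 * (Gamma (1 + α / 2) ^ 2 / Gamma (1 + α)) * 1 *
      (Gamma 2 * Gamma (2 - 2 * (1 - α / 2)) / Gamma (2 - (1 - α / 2)) ^ 2) = α / 2 := by
    rw [show 2 - 2 * (1 - α / 2) = α by ring, show 2 - (1 - α / 2) = 1 + α / 2 by ring,
      Gamma_two, add_comm 1 α, Gamma_add_one hα0.ne']
    have h1 := (Gamma_pos_of_pos hα0).ne'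
    have h2 := (Gamma_pos_of_pos (show 0 < 1 + α / 2 by linarith)).ne'
    field_simp
  rw [hval] at h
  refine h.congr' ?_
  filter_upwards [Ioo_mem_nhdsLT (zero_lt_one' ℝ)] with r hr
  exact (hasDerivAt_Mfun hα hr).deriv.symm
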